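/- For all integers m, n ≥ 0 and all real x ≥ 0: ∫_0^x I_n(t) I_m(x−t) dt = 2 ∑_{k=0}^∞ I_{m+n+2k+1}(x). -/

import Mathlib

/-- The modified Bessel function of the first kind of integer order `n ≥ 0`:
`I_n(t) = ∑_{k=0}^∞ (t/2)^{2k+n}/(k!(k+n)!)`. -/
noncomputable def besselI (n : ℕ) (t : ℝ) : ℝ :=
  ∑' k : ℕ, (t / 2) ^ (2 * k + n) / ((k.factorial : ℝ) * ((k + n).factorial : ℝ))

/-- sums of binomials -/
def bcA (n m s : ℕ) : ℕ := ∑ i ∈ Finset.range (s+1), Nat.choose (2*i+n) i * Nat.choose (2*(s-i)+m) (s-i)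

def bcB (p s : ℕ) : ℕ := ∑ i ∈ Finset.range (s+1), Nat.choose (2*s+p+1) i

lemma bcB_zero (p : ℕ) : bcB p 0 = 1 := by simp [bcB]
lemma bcA_zero (n m : ℕ) : bcA n m 0 = 1 := by simp [bcA]

lemma sum_choose_succ (N s : ℕ) : ∑ i ∈ Finset.range (s+2), Nat.choose (N+1) i =
    ∑ i ∈ Finset.range (s+2), Nat.choose N i + ∑ i ∈ Finset.range (s+1), Nat.choose N i := by
  rw [Finset.sum_range_succ', Finset.sum_range_succ' (fun i => Nat.choose N i)]
  simp only [Nat.choose_succ_succ', Finset.sum_add_distrib]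
  simp; ring

lemma bcB_succ (p s : ℕ) : bcB (p+1) (s+1) = bcB p (s+1) + bcB (p+2) s := by
  unfold bcB
  have h := sum_choose_succ (2*s+p+3) s
  rw [show 2*(s+1)+(p+1)+1 = 2*s+p+3+1 by ring, show 2*(s+1)+p+1 = 2*s+p+3 by ring,
    show 2*s+(p+2)+1 = 2*s+p+3 by ring]
  exact h

lemma bcA_succ (n m s : ℕ) : bcA (n+1) m (s+1) = bcA n m (s+1) + bcA (n+2) m s := by
  unfold bcA
  rw [Finset.sum_range_succ', Finset.sum_range_succ' (n := s+1)]
  have h : ∀ i, Nat.choose (2*(i+1)+(n+1)) (i+1) =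
      Nat.choose (2*(i+1)+n) (i+1) + Nat.choose (2*i+(n+2)) i := by
    intro i
    rw [show 2*(i+1)+(n+1) = 2*i+(n+2)+1 by ring, show 2*(i+1)+n = 2*i+(n+2) by ring,
      Nat.choose_succ_succ']
    ring
  simp only [h, add_mul, Finset.sum_add_distrib, Nat.add_sub_add_right]
  simp; ring

lemma bcA_base (m s : ℕ) : bcA 0 m (s+1) = Nat.choose (2*(s+1)+m) (s+1) + 2 * bcA 1 m s := by
  unfold bcA
  rw [Finset.sum_range_succ']
  have h : ∀ i, Nat.choose (2*(i+1)+0) (i+1) = 2 * Nat.choose (2*i+1) i := by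
    intro i
    rw [show 2*(i+1)+0 = 2*i+1+1 by ring, Nat.choose_succ_succ',
      Nat.choose_symm_half]
    ring
  simp only [h, Nat.add_sub_add_right, Finset.mul_sum, mul_assoc]
  simp; ring

lemma bcB_base (m s : ℕ) : bcB m (s+1) = Nat.choose (2*(s+1)+m) (s+1) + 2 * bcB (m+1) s := by
  unfold bcB
  have h := sum_choose_succ (2*(s+1)+m) s
  rw [Finset.sum_range_succ (fun i => Nat.choose (2*(s+1)+m) i)] at h
  rw [show 2*s+(m+1)+1 = 2*(s+1)+m by ring]
  rw [h]; ring

lemma bcA_eq (s : ℕ) : ∀ n m, bcA n m s = bcB (m+n) s := by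
  induction s with
  | zero => intro n m; rw [bcA_zero, bcB_zero]
  | succ s ih =>
    intro n m
    induction n with
    | zero => rw [bcA_base, ih, add_zero, bcB_base]
    | succ n ihn => rw [bcA_succ, ihn, ih, ← add_assoc, ← add_assoc, bcB_succ]

lemma beta_nat (x : ℝ) (b : ℕ) : ∀ a : ℕ, ∫ t in (0:ℝ)..x, t^a * (x-t)^b =
    (a.factorial * b.factorial : ℝ) / ((a+b+1).factorial : ℝ) * x^(a+b+1) := by
  induction b with
  | zero =>
    intro a
    simp only [pow_zero, mul_one, integral_pow, add_zero, Nat.factorial_succ, Nat.factorial_zero]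
    have := Nat.factorial_ne_zero a
    push_cast
    field_simp
    simp
  | succ b ih =>
    intro a
    have hd : ∀ t ∈ Set.uIcc 0 x, HasDerivAt (fun t : ℝ => t^(a+1) * (x-t)^(b+1))
        (((a:ℝ)+1) * (t^a * (x-t)^(b+1)) - ((b:ℝ)+1) * (t^(a+1) * (x-t)^b)) t := by
      intro t _
      have h1 := (hasDerivAt_pow (a+1) t).mul (((hasDerivAt_id t).const_sub x).pow (b+1))
      refine (h1.congr_deriv ?_)
      simp
      ring
    have h := intervalIntegral.integral_eq_sub_of_hasDerivAt hd
      (Continuous.intervalIntegrable (by fun_prop) _ _)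
    rw [intervalIntegral.integral_sub (Continuous.intervalIntegrable (by fun_prop) _ _)
      (Continuous.intervalIntegrable (by fun_prop) _ _),
      intervalIntegral.integral_const_mul, intervalIntegral.integral_const_mul, ih] at h
    simp at h
    have ha : (a:ℝ)+1 ≠ 0 := by positivity
    apply mul_left_cancel₀ ha
    rw [show a + 1 + b + 1 = a + (b+1) + 1 by ring] at h
    rw [sub_eq_zero.1 h, Nat.factorial_succ a, Nat.factorial_succ b]
    push_cast
    ring

lemma tsum_prod_range {f : ℕ × ℕ → ℝ} (hf : Summable f) :
    ∑' p, f p = ∑' s, ∑ i ∈ Finset.range (s+1), f (i, s-i) := by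
  rw [← Finset.HasAntidiagonal.sigmaAntidiagonalEquivProd.tsum_eq f]
  have h := Finset.HasAntidiagonal.sigmaAntidiagonalEquivProd.summable_iff.mpr hf
  refine (Summable.tsum_sigma' (fun n => (hasSum_fintype _).summable) h).trans ?_
  congr 1
  ext s
  rw [tsum_fintype, ← Finset.Nat.sum_antidiagonal_eq_sum_range_succ_mk]
  exact Finset.sum_coe_sort (Finset.HasAntidiagonal.antidiagonal s) f

noncomputable def bterm (n : ℕ) (t : ℝ) (k : ℕ) : ℝ :=
  (t / 2) ^ (2 * k + n) / ((k.factorial : ℝ) * ((k + n).factorial : ℝ))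

lemma bterm_nonneg (n : ℕ) {t : ℝ} (ht : 0 ≤ t) (k : ℕ) : 0 ≤ bterm n t k := by
  unfold bterm; positivity

lemma bterm_mono (n : ℕ) {t x : ℝ} (ht : 0 ≤ t) (h : t ≤ x) (k : ℕ) :
    bterm n t k ≤ bterm n x k := by
  unfold bterm; gcongr

lemma bterm_summable (n : ℕ) {t : ℝ} (ht : 0 ≤ t) : Summable (bterm n t) := by
  refine Summable.of_nonneg_of_le (bterm_nonneg n ht) (fun k => ?_)
    ((Real.summable_pow_div_factorial ((t/2)^2)).mul_left ((t/2)^n))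
  unfold bterm
  rw [pow_add, pow_mul, mul_comm ((t/2)^n), div_mul_eq_mul_div]
  gcongr
  have : (1:ℝ) ≤ ((k+n).factorial : ℝ) := by exact_mod_cast Nat.factorial_pos _
  have h2 : (0:ℝ) ≤ (k.factorial : ℝ) := by positivity
  nlinarith

lemma rhs_summable (p : ℕ) {x : ℝ} (hx : 0 ≤ x) :
    Summable (fun q : ℕ × ℕ => bterm (p + 2 * q.2 + 1) x q.1) := by
  have h1 := Real.summable_pow_div_factorial ((x/2)^2)
  have h2 := ((Real.summable_pow_div_factorial ((x/2)^2)).mul_left ((x/2)^(p+1)))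
  refine Summable.of_nonneg_of_le (fun q => bterm_nonneg _ hx _) (fun q => ?_)
    (h1.mul_of_nonneg h2 (fun _ => by positivity) (fun _ => by positivity))
  unfold bterm
  rw [← mul_div_assoc, div_mul_div_comm, show (x/2)^(2*q.1 + (p+2*q.2+1)) =
    ((x/2)^2)^q.1 * ((x/2)^(p+1) * ((x/2)^2)^q.2) by
      rw [← pow_mul, ← pow_mul, ← pow_add, ← pow_add]; congr 1; ring]
  gcongr
  omega

lemma int_summable (m n : ℕ) {x : ℝ} (hx : 0 ≤ x) :
    HasSum (fun q : ℕ × ℕ => ∫ t in (0:ℝ)..x, bterm n t q.1 * bterm m (x-t) q.2)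
      (∫ t in (0:ℝ)..x, besselI n t * besselI m (x - t)) := by
  have hs : ∀ {t u : ℝ}, 0 ≤ t → 0 ≤ u →
      Summable (fun q : ℕ × ℕ => bterm n t q.1 * bterm m u q.2) := fun ht hu =>
    (bterm_summable n ht).mul_of_nonneg (bterm_summable m hu) (bterm_nonneg n ht)
      (bterm_nonneg m hu)
  apply intervalIntegral.hasSum_integral_of_dominated_convergence
    (fun q _ => bterm n x q.1 * bterm m x q.2)
  · intro q
    apply Continuous.aestronglyMeasurable
    unfold bterm
    fun_prop
  · intro q
    refine Filter.Eventually.of_forall (fun t ht => ?_)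
    rw [Set.uIoc_of_le hx] at ht
    have h0 : 0 ≤ x - t := by linarith [ht.2]
    rw [Real.norm_of_nonneg (mul_nonneg (bterm_nonneg n ht.1.le _) (bterm_nonneg m h0 _))]
    exact mul_le_mul (bterm_mono n ht.1.le ht.2 _) (bterm_mono m h0 (by linarith [ht.1]) _)
      (bterm_nonneg m h0 _) (bterm_nonneg n hx _)
  · exact Filter.Eventually.of_forall (fun t _ => hs hx hx)
  · exact intervalIntegrable_const
  · refine Filter.Eventually.of_forall (fun t ht => ?_)
    rw [Set.uIoc_of_le hx] at ht
    have h0 : 0 ≤ x - t := by linarith [ht.2]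
    have h := (hs ht.1.le h0).hasSum
    rwa [← (bterm_summable n ht.1.le).tsum_mul_tsum (bterm_summable m h0) (hs ht.1.le h0)] at h

lemma int_term (m n j k : ℕ) (x : ℝ) :
    ∫ t in (0:ℝ)..x, bterm n t j * bterm m (x-t) k =
      2 * (x/2)^(2*(j+k)+(m+n)+1) / ((2*(j+k)+(m+n)+1).factorial : ℝ) *
        ((Nat.choose (2*j+n) j * Nat.choose (2*k+m) k : ℕ) : ℝ) := by
  have e : ∀ t : ℝ, bterm n t j * bterm m (x-t) k =
      ((1/2)^(2*j+n) * (1/2)^(2*k+m) / (((j.factorial : ℝ) * ((j + n).factorial : ℝ)) *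
        ((k.factorial : ℝ) * ((k + m).factorial : ℝ)))) * (t^(2*j+n) * (x-t)^(2*k+m)) := by
    intro t
    unfold bterm
    rw [div_mul_div_comm, div_eq_mul_one_div t, div_eq_mul_one_div (x-t), mul_pow, mul_pow]
    ring
  simp only [e]
  rw [intervalIntegral.integral_const_mul, beta_nat,
    show 2*j+n+(2*k+m)+1 = 2*(j+k)+(m+n)+1 by ring, Nat.cast_mul,
    Nat.cast_choose ℝ (show j ≤ 2*j+n by omega), Nat.cast_choose ℝ (show k ≤ 2*k+m by omega),
    show 2*j+n-j = j+n by omega, show 2*k+m-k = k+m by omega, div_eq_mul_one_div x, mul_pow,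
    show ((1:ℝ)/2)^(2*(j+k)+(m+n)+1) = (1/2)^(2*j+n) * (1/2)^(2*k+m) * (1/2) by ring]
  field_simp

lemma rhs_term (p l s : ℕ) (h : l ≤ s) (x : ℝ) :
    bterm (p + 2 * (s - l) + 1) x l = (x/2)^(2*s+p+1) / ((2*s+p+1).factorial : ℝ) *
        (Nat.choose (2*s+p+1) l : ℝ) := by
  unfold bterm
  rw [Nat.cast_choose ℝ (show l ≤ 2*s+p+1 by omega),
    show 2*s+p+1-l = l + (p + 2 * (s - l) + 1) by omega,
    show 2*l+(p + 2 * (s - l) + 1) = 2*s+p+1 by omega]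
  field_simp

/-- The `I`-Bessel convolution formula:
`∫_0^x I_n(t) I_m(x−t) dt = 2 ∑_{k=0}^∞ I_{m+n+2k+1}(x)` for integers `m, n ≥ 0`
and real `x ≥ 0`. -/
theorem besselI_convolution (m n : ℕ) (x : ℝ) (hx : 0 ≤ x) :
    ∫ t in (0:ℝ)..x, besselI n t * besselI m (x - t) =
      2 * ∑' k : ℕ, besselI (m + n + 2 * k + 1) x := by
  have hL := int_summable m n hx
  rw [← hL.tsum_eq, tsum_prod_range hL.summable]
  have hR := rhs_summable (m+n) hx
  have e : ∑' k : ℕ, besselI (m + n + 2 * k + 1) x =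
      ∑' q : ℕ × ℕ, bterm (m + n + 2 * q.2 + 1) x q.1 := by
    have h1 : Summable (fun q : ℕ × ℕ => bterm (m + n + 2 * q.1 + 1) x q.2) :=
      (Equiv.prodComm ℕ ℕ).summable_iff.mpr hR
    have h2 := h1.tsum_prod' (fun k => bterm_summable (m + n + 2 * k + 1) hx)
    have h3 : ∑' q : ℕ × ℕ, bterm (m + n + 2 * q.1 + 1) x q.2 =
        ∑' q : ℕ × ℕ, bterm (m + n + 2 * q.2 + 1) x q.1 :=
      (Equiv.prodComm ℕ ℕ).tsum_eq (fun q : ℕ × ℕ => bterm (m + n + 2 * q.2 + 1) x q.1)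
    rw [← h3, h2]
    rfl
  rw [e, tsum_prod_range hR, ← tsum_mul_left]
  congr 1
  ext s
  have h1 : ∑ i ∈ Finset.range (s+1), bterm (m + n + 2 * (s - i) + 1) x i =
      (x/2)^(2*s+(m+n)+1) / ((2*s+(m+n)+1).factorial : ℝ) * (bcB (m+n) s : ℝ) := by
    unfold bcB
    rw [Nat.cast_sum, Finset.mul_sum]
    exact Finset.sum_congr rfl (fun i hi => rhs_term _ _ _
      (by have := Finset.mem_range.1 hi; omega) _)
  rw [h1, ← bcA_eq, bcA, Nat.cast_sum, Finset.mul_sum, Finset.mul_sum]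
  refine Finset.sum_congr rfl (fun i hi => ?_)
  have hi' := Finset.mem_range.1 hi
  rw [int_term, show i + (s - i) = s by omega]
  ring
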